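/- arXiv:2101.07587 — 2 statements merged into one kernel-verified Lean document; each statement's English description precedes it below -/
import Mathlib

section
/- Let W₁ be a graphon on a probability space (S₁, μ₁) and W₂ a graphon on a probability space (S₂, μ₂). Suppose W₁ and W₂ are equivalent, i.e., there exist a graphon U on a probability space (S, μ) and measure-preserving maps φ₁ : S₁ → S and φ₂ : S₂ → S such that W_j(x,y) = U(φ_j(x), φ_j(y)) almost everywhere on S_j × S_j for j = 1, 2. Then Ψ_q(W₁) = Ψ_q(W₂) for every q > 0. -/
open MeasureTheory
open scoped ENNReal

/-- The smoothness functional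
`Ψ_q(W) = ∫∫ (∫ |W(x,z) − W(y,z)| dμ(z))^{−q} dμ(x) dμ(y) ∈ [0,∞]`. -/
noncomputable def Psi {S : Type*} [MeasurableSpace S] (μ : Measure S) (q : ℝ)
    (W : S → S → ℝ) : ℝ≥0∞ :=
  ∫⁻ x, ∫⁻ y, (∫⁻ z, ENNReal.ofReal |W x z - W y z| ∂μ) ^ (-q) ∂μ ∂μ

/-- `Psi` depends only on the almost everywhere class of the kernel. -/
theorem Psi_congr_ae {S : Type*} [MeasurableSpace S] (μ : Measure S) [SFinite μ] (q : ℝ)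
    {W V : S → S → ℝ} (h : ∀ᵐ p ∂(μ.prod μ), W p.1 p.2 = V p.1 p.2) :
    Psi μ q W = Psi μ q V := by
  have h' : ∀ᵐ x ∂μ, ∀ᵐ z ∂μ, W x z = V x z := Measure.ae_ae_of_ae_prod h
  unfold Psi
  refine lintegral_congr_ae ?_
  filter_upwards [h'] with x hx
  refine lintegral_congr_ae ?_
  filter_upwards [h'] with y hy
  congr 1
  refine lintegral_congr_ae ?_
  filter_upwards [hx, hy] with z hxz hyz
  rw [hxz, hyz]

/-- `Psi` is invariant under pull-backs by measure-preserving maps. -/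
theorem Psi_comp_measurePreserving {S T : Type*} [MeasurableSpace S] [MeasurableSpace T]
    {ν : Measure T} {μ : Measure S} [SFinite μ] {φ : T → S} (hφ : MeasurePreserving φ ν μ)
    (q : ℝ) {U : S → S → ℝ} (hU : Measurable (Function.uncurry U)) :
    Psi ν q (fun x y => U (φ x) (φ y)) = Psi μ q U := by
  have hdist : Measurable fun p : (S × S) × S => ENNReal.ofReal |U p.1.1 p.2 - U p.1.2 p.2| :=
    (((hU.comp (by fun_prop : Measurable fun p : (S × S) × S => (p.1.1, p.2))).sub
      (hU.comp (by fun_prop : Measurable fun p : (S × S) × S => (p.1.2, p.2)))).norm).ennreal_ofReal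
  have hpow : Measurable fun p : S × S =>
      (∫⁻ z, ENNReal.ofReal |U p.1 z - U p.2 z| ∂μ) ^ (-q) :=
    hdist.lintegral_prod_right'.pow_const _
  have hz (a b : S) : ∫⁻ z, ENNReal.ofReal |U a (φ z) - U b (φ z)| ∂ν
      = ∫⁻ z, ENNReal.ofReal |U a z - U b z| ∂μ :=
    hφ.lintegral_comp (hdist.comp (measurable_prodMk_left (x := (a, b))))
  have hy (a : S) : ∫⁻ y, (∫⁻ z, ENNReal.ofReal |U a z - U (φ y) z| ∂μ) ^ (-q) ∂ν
      = ∫⁻ y, (∫⁻ z, ENNReal.ofReal |U a z - U y z| ∂μ) ^ (-q) ∂μ :=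
    hφ.lintegral_comp (hpow.comp (measurable_prodMk_left (x := a)))
  simp only [Psi, hz, hy]
  exact hφ.lintegral_comp hpow.lintegral_prod_right'

/-- **Lemma 1.** Equivalent graphons have the same `Ψ_q` for every `q > 0`. -/
theorem Psi_eq_of_equivalent {S₁ S₂ S : Type*}
    [MeasurableSpace S₁] [MeasurableSpace S₂] [MeasurableSpace S]
    (μ₁ : Measure S₁) (μ₂ : Measure S₂) (μ : Measure S)
    [IsProbabilityMeasure μ₁] [IsProbabilityMeasure μ₂] [IsProbabilityMeasure μ]
    (W₁ : S₁ → S₁ → ℝ) (W₂ : S₂ → S₂ → ℝ) (U : S → S → ℝ)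
    (hW₁meas : Measurable (Function.uncurry W₁))
    (hW₁symm : ∀ x y, W₁ x y = W₁ y x)
    (hW₁01 : ∀ x y, W₁ x y ∈ Set.Icc (0:ℝ) 1)
    (hW₂meas : Measurable (Function.uncurry W₂))
    (hW₂symm : ∀ x y, W₂ x y = W₂ y x)
    (hW₂01 : ∀ x y, W₂ x y ∈ Set.Icc (0:ℝ) 1)
    (hUmeas : Measurable (Function.uncurry U))
    (hUsymm : ∀ x y, U x y = U y x)
    (hU01 : ∀ x y, U x y ∈ Set.Icc (0:ℝ) 1)
    (φ₁ : S₁ → S) (φ₂ : S₂ → S)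
    (hφ₁ : MeasurePreserving φ₁ μ₁ μ) (hφ₂ : MeasurePreserving φ₂ μ₂ μ)
    (hW₁ae : ∀ᵐ p ∂(μ₁.prod μ₁), W₁ p.1 p.2 = U (φ₁ p.1) (φ₁ p.2))
    (hW₂ae : ∀ᵐ p ∂(μ₂.prod μ₂), W₂ p.1 p.2 = U (φ₂ p.1) (φ₂ p.2))
    (q : ℝ) (hq : 0 < q) :
    Psi μ₁ q W₁ = Psi μ₂ q W₂ := by
  rw [Psi_congr_ae μ₁ q (V := fun x y => U (φ₁ x) (φ₁ y)) hW₁ae,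
    Psi_congr_ae μ₂ q (V := fun x y => U (φ₂ x) (φ₂ y)) hW₂ae,
    Psi_comp_measurePreserving hφ₁ q hUmeas, Psi_comp_measurePreserving hφ₂ q hUmeas]
end

section
/- Let d ≥ 2, 0 < α < 1, let h_α(t) := Σ_{k=0}^∞ 2^{−kα} cos(2π·2^k t), let a > 0 satisfy a·d·Σ_{k=0}^∞ 2^{−kα} ≤ 1/2, and let W(x,y) := 1/2 + a Σ_{i=1}^d h_α(x_i − y_i) on [0,1]^d × [0,1]^d. Then there exists a constant c > 0 such that for all x, y ∈ [0,1]^d, ∫_{[0,1]^d} |W(x,z) − W(y,z)| dz ≥ c · ( Σ_{i=1}^d min(|x_i − y_i|, 1 − |x_i − y_i|) )^α. -/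
open MeasureTheory
open scoped ENNReal

/-- The unit cube `[0,1]^d` in Euclidean space. -/
def unitCube (d : ℕ) : Set (EuclideanSpace ℝ (Fin d)) :=
  {x | ∀ i, x i ∈ Set.Icc (0:ℝ) 1}

/-- The Weierstrass function `h_α(t) = Σ_{k≥0} 2^{−kα} cos(2π·2^k t)`. -/
noncomputable def weierstrass (α : ℝ) (t : ℝ) : ℝ :=
  ∑' k : ℕ, (2:ℝ) ^ (-(k:ℝ) * α) * Real.cos (2 * Real.pi * 2 ^ k * t)

/-- The Weierstrass-type graphon `W(x,y) = 1/2 + a Σ_i h_α(x_i − y_i)` on `[0,1]^d`. -/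
noncomputable def weierstrassGraphon (d : ℕ) (α a : ℝ)
    (x y : EuclideanSpace ℝ (Fin d)) : ℝ :=
  1 / 2 + a * ∑ i, weierstrass α (x i - y i)

lemma cos_summand_norm_le (α x t : ℝ) (k : ℕ) :
    ‖(2:ℝ) ^ (-(k:ℝ) * α) * Real.cos (2 * Real.pi * 2 ^ k * (x - t))‖ ≤
      (2:ℝ) ^ (-(k:ℝ) * α) := by
  have h : (0:ℝ) < (2:ℝ) ^ (-(k:ℝ) * α) := by positivity
  rw [norm_mul, Real.norm_of_nonneg h.le]
  exact mul_le_of_le_one_right h.le (Real.abs_cos_le_one _)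

lemma summable_two_rpow {α : ℝ} (hα : 0 < α) :
    Summable fun k : ℕ => (2:ℝ) ^ (-(k:ℝ) * α) := by
  have h : ∀ k : ℕ, (2:ℝ) ^ (-(k:ℝ) * α) = ((2:ℝ) ^ (-α)) ^ k := fun k => by
    rw [← Real.rpow_natCast, ← Real.rpow_mul (by norm_num)]
    ring_nf
  simp_rw [h]
  exact summable_geometric_of_lt_one (by positivity)
    (Real.rpow_lt_one_of_one_lt_of_neg (by norm_num) (by linarith))

lemma continuous_weierstrass {α : ℝ} (hα : 0 < α) : Continuous (weierstrass α) := by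
  unfold weierstrass
  refine continuous_tsum (fun k => by fun_prop) (summable_two_rpow hα) fun k t => ?_
  simpa using cos_summand_norm_le α t 0 k

lemma integral_sin_int_mul_add {n : ℤ} (hn : n ≠ 0) (c : ℝ) :
    ∫ t in (0:ℝ)..1, Real.sin (2 * Real.pi * n * t + c) = 0 := by
  have hn' : (2 * Real.pi * n : ℝ) ≠ 0 := by
    have : (n:ℝ) ≠ 0 := by exact_mod_cast hn
    positivity
  rw [intervalIntegral.integral_comp_mul_add (fun s => Real.sin s) hn' c, integral_sin]
  have : 2 * Real.pi * n * 1 + c = c + n * (2 * Real.pi) := by ring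
  rw [this, Real.cos_add_int_mul_two_pi]
  simp

/-- Orthogonality of the dyadic frequencies. -/
lemma integral_cos_mul_sin_dyadic (x m : ℝ) (k l : ℕ) :
    ∫ t in (0:ℝ)..1, Real.cos (2 * Real.pi * 2 ^ l * (x - t)) *
        Real.sin (2 * Real.pi * 2 ^ k * (t - m)) =
      if l = k then Real.sin (2 * Real.pi * 2 ^ k * (x - m)) / 2 else 0 := by
  have key : ∀ t : ℝ, Real.cos (2 * Real.pi * 2 ^ l * (x - t)) *
        Real.sin (2 * Real.pi * 2 ^ k * (t - m)) =
      2⁻¹ * (Real.sin (2 * Real.pi * ((2 ^ k - 2 ^ l : ℤ) : ℝ) * t +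
          2 * Real.pi * (2 ^ l * x - 2 ^ k * m)) +
        Real.sin (2 * Real.pi * ((2 ^ k + 2 ^ l : ℤ) : ℝ) * t -
          2 * Real.pi * (2 ^ l * x + 2 ^ k * m))) := fun t => by
    have h1 : 2 * Real.pi * ((2 ^ k - 2 ^ l : ℤ) : ℝ) * t +
          2 * Real.pi * (2 ^ l * x - 2 ^ k * m) =
        2 * Real.pi * 2 ^ k * (t - m) + 2 * Real.pi * 2 ^ l * (x - t) := by
      push_cast; ring
    have h2 : 2 * Real.pi * ((2 ^ k + 2 ^ l : ℤ) : ℝ) * t -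
          2 * Real.pi * (2 ^ l * x + 2 ^ k * m) =
        2 * Real.pi * 2 ^ k * (t - m) - 2 * Real.pi * 2 ^ l * (x - t) := by
      push_cast; ring
    rw [h1, h2, Real.sin_add, Real.sin_sub]
    ring
  simp_rw [key]
  rw [intervalIntegral.integral_const_mul, intervalIntegral.integral_add
    (Continuous.intervalIntegrable (by fun_prop) _ _)
    (Continuous.intervalIntegrable (by fun_prop) _ _)]
  have hpos : (2 ^ k + 2 ^ l : ℤ) ≠ 0 := by positivity
  have h0 := integral_sin_int_mul_add hpos (-(2 * Real.pi * (2 ^ l * x + 2 ^ k * m)))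
  simp_rw [← sub_eq_add_neg] at h0
  rw [h0]
  split_ifs with h
  · subst h
    simp only [sub_self, Int.cast_zero, mul_zero, zero_mul, zero_add,
      intervalIntegral.integral_const]
    simp
    ring_nf
  · have : (2 ^ k - 2 ^ l : ℤ) ≠ 0 := fun h' => h <| by
      have : (2 ^ k : ℤ) = 2 ^ l := by linarith
      exact (pow_right_injective₀ (by norm_num) (by norm_num) this).symm
    rw [integral_sin_int_mul_add this]
    simp

/-- Pairing a translate of the Weierstrass function with one frequency reads off that term. -/
lemma integral_weierstrass_mul_sin {α : ℝ} (hα : 0 < α) (x m : ℝ) (k : ℕ) :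
    ∫ t in (0:ℝ)..1, weierstrass α (x - t) * Real.sin (2 * Real.pi * 2 ^ k * (t - m)) =
      (2:ℝ) ^ (-(k:ℝ) * α) * (Real.sin (2 * Real.pi * 2 ^ k * (x - m)) / 2) := by
  have hs := summable_two_rpow hα
  have h := intervalIntegral.hasSum_integral_of_dominated_convergence
    (μ := volume) (a := 0) (b := 1)
    (F := fun (l : ℕ) (t : ℝ) => (2:ℝ) ^ (-(l:ℝ) * α) *
      Real.cos (2 * Real.pi * 2 ^ l * (x - t)) * Real.sin (2 * Real.pi * 2 ^ k * (t - m)))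
    (f := fun t => weierstrass α (x - t) * Real.sin (2 * Real.pi * 2 ^ k * (t - m)))
    (fun (l : ℕ) _ => (2:ℝ) ^ (-(l:ℝ) * α))
    (fun l => (by fun_prop : Continuous _).aestronglyMeasurable)
    (fun l => Filter.Eventually.of_forall fun t _ => ?_)
    (Filter.Eventually.of_forall fun t _ => hs)
    (by simp)
    (Filter.Eventually.of_forall fun t _ =>
      ((Summable.of_norm_bounded hs (cos_summand_norm_le α x t)).hasSum).mul_right _)
  · simp_rw [mul_assoc _ (Real.cos _), intervalIntegral.integral_const_mul,
      integral_cos_mul_sin_dyadic] at h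
    rw [← h.tsum_eq, tsum_eq_single k (fun l hl => by simp [hl])]
    simp
  · rw [norm_mul]
    exact (mul_le_of_le_one_right (norm_nonneg _) (Real.abs_sin_le_one _)).trans
      (cos_summand_norm_le α x t l)

lemma integral_weierstrass_sub_mul_sin {α : ℝ} (hα : 0 < α) (x y : ℝ) (k : ℕ) :
    ∫ t in (0:ℝ)..1, (weierstrass α (x - t) - weierstrass α (y - t)) *
        Real.sin (2 * Real.pi * 2 ^ k * (t - (x + y) / 2)) =
      (2:ℝ) ^ (-(k:ℝ) * α) * Real.sin (Real.pi * 2 ^ k * (x - y)) := by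
  have hc := continuous_weierstrass hα
  simp_rw [sub_mul]
  rw [intervalIntegral.integral_sub (Continuous.intervalIntegrable (by fun_prop) _ _)
    (Continuous.intervalIntegrable (by fun_prop) _ _),
    integral_weierstrass_mul_sin hα, integral_weierstrass_mul_sin hα]
  have h1 : 2 * Real.pi * 2 ^ k * (x - (x + y) / 2) = Real.pi * 2 ^ k * (x - y) := by ring
  have h2 : 2 * Real.pi * 2 ^ k * (y - (x + y) / 2) = -(Real.pi * 2 ^ k * (x - y)) := by ring
  rw [h1, h2, Real.sin_neg]
  ring

/-- Every circle distance is scaled by some power of two to a place where the sine is large. -/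
lemma exists_half_rpow_le_abs_sin {α : ℝ} (hα : 0 < α) {u : ℝ}
    (hδ : 0 < min |u| (1 - |u|)) :
    ∃ k : ℕ, 1 / 2 * (min |u| (1 - |u|)) ^ α ≤
      (2:ℝ) ^ (-(k:ℝ) * α) * |Real.sin (Real.pi * 2 ^ k * u)| := by
  set δ := min |u| (1 - |u|) with hδ_def
  have hδ2 : δ ≤ 1 / 2 := by
    have h1 := min_le_left |u| (1 - |u|)
    have h2 := min_le_right |u| (1 - |u|)
    linarith
  have hsin : ∀ k : ℕ, |Real.sin (Real.pi * 2 ^ k * u)| = |Real.sin (Real.pi * 2 ^ k * δ)| := by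
    intro k
    have habs : |Real.sin (Real.pi * 2 ^ k * |u|)| = |Real.sin (Real.pi * 2 ^ k * u)| := by
      rcases abs_choice u with h | h <;> rw [h]
      rw [mul_neg, Real.sin_neg, abs_neg]
    rcases min_choice |u| (1 - |u|) with h | h <;> rw [hδ_def, h]
    · exact habs.symm
    · have : Real.pi * 2 ^ k * (1 - |u|) = (2 ^ k : ℕ) * Real.pi - Real.pi * 2 ^ k * |u| := by
        push_cast; ring
      rw [this, Real.sin_nat_mul_pi_sub, abs_neg, abs_mul, habs]
      simp
  obtain ⟨k, hk1, hk2⟩ := exists_nat_pow_near (x := 1 / (2 * δ)) (y := (2:ℝ))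
    (by rw [le_div_iff₀ (by positivity)]; linarith) (by norm_num)
  refine ⟨k, ?_⟩
  rw [hsin]
  rw [le_div_iff₀ (by positivity)] at hk1
  rw [div_lt_iff₀ (by positivity), pow_succ] at hk2
  have hpi := Real.pi_pos
  have hs : 1 / 2 ≤ |Real.sin (Real.pi * 2 ^ k * δ)| := by
    refine le_trans ?_ (le_abs_self _)
    refine le_trans ?_ (Real.mul_le_sin (by positivity) (by nlinarith))
    have : 2 / Real.pi * (Real.pi * 2 ^ k * δ) = 2 * 2 ^ k * δ := by field_simp
    rw [this]
    linarith
  have hr : δ ^ α ≤ (2:ℝ) ^ (-(k:ℝ) * α) := by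
    rw [Real.rpow_mul (by norm_num)]
    refine Real.rpow_le_rpow hδ.le ?_ hα.le
    rw [Real.rpow_neg (by norm_num), Real.rpow_natCast, ← one_div, le_div_iff₀ (by positivity)]
    have : 0 < (2:ℝ) ^ k * δ := by positivity
    linarith
  have h0 : 0 ≤ δ ^ α := by positivity
  calc 1 / 2 * δ ^ α = δ ^ α * (1 / 2) := by ring
    _ ≤ _ := by gcongr

/-- In a product of probability spaces, a centred function of one coordinate only sees that
coordinate of a sum. -/
lemma integral_pi_sum_mul_eval {ι : Type*} [Fintype ι] (μ : Measure ℝ) [IsProbabilityMeasure μ]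
    {g : ι → ℝ → ℝ} {ψ : ℝ → ℝ} (hg : ∀ i, Continuous (g i)) (hψ : Continuous ψ) (j : ι)
    (hint : ∀ i, Integrable (fun z : ι → ℝ => g i (z i) * ψ (z j)) (Measure.pi fun _ => μ))
    (hψ0 : ∫ t, ψ t ∂μ = 0) :
    ∫ z : ι → ℝ, (∑ i, g i (z i)) * ψ (z j) ∂(Measure.pi fun _ => μ) =
      ∫ t, g j t * ψ t ∂μ := by
  simp_rw [Finset.sum_mul]
  rw [integral_finsetSum _ fun i _ => hint i, Finset.sum_eq_single j]
  · exact integral_comp_eval (μ := fun _ : ι => μ) (i := j) (f := fun t => g j t * ψ t)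
      (by fun_prop : Continuous _).aestronglyMeasurable
  · intro i _ hij
    have hind := (ProbabilityTheory.iIndepFun_pi (μ := fun _ : ι => μ) (X := fun _ t => t)
      fun _ => aemeasurable_id').indepFun hij
    have := (hind.comp (hg i).measurable hψ.measurable).integral_fun_mul_eq_mul_integral
      (by have := hg i; exact (by fun_prop : Continuous _).aestronglyMeasurable)
      (by exact (by fun_prop : Continuous _).aestronglyMeasurable)
    simp only [Function.comp_apply] at this
    rw [this]
    have h0 : ∫ z : ι → ℝ, ψ (z j) ∂(Measure.pi fun _ => μ) = 0 := by
      rw [← hψ0]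
      exact integral_comp_eval (μ := fun _ : ι => μ) (i := j) (f := ψ) hψ.aestronglyMeasurable
    simp [h0]
  · simp

/-- The unit cube as a probability space is a product of unit intervals. -/
lemma setIntegral_unitCube (d : ℕ) (F : EuclideanSpace ℝ (Fin d) → ℝ) :
    ∫ z in unitCube d, F z =
      ∫ z : Fin d → ℝ, F (WithLp.toLp 2 z)
        ∂(Measure.pi fun _ => volume.restrict (Set.Icc (0:ℝ) 1)) := by
  rw [← (PiLp.volume_preserving_toLp (Fin d)).setIntegral_preimage_emb
    (MeasurableEquiv.toLp 2 _).measurableEmbedding, ← Measure.restrict_pi_pi, ← volume_pi]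
  congr 2
  ext z
  simp only [unitCube, Set.mem_preimage, Set.mem_ofPred_eq, Set.mem_univ_pi]

lemma weierstrassGraphon_integral_ge_term {d : ℕ} {α a : ℝ} (hα : 0 < α) (ha : 0 < a)
    (x y : EuclideanSpace ℝ (Fin d)) (j : Fin d) (k : ℕ) :
    a * ((2:ℝ) ^ (-(k:ℝ) * α) * |Real.sin (Real.pi * 2 ^ k * (x j - y j))|) ≤
      ∫ z in unitCube d, |weierstrassGraphon d α a x z - weierstrassGraphon d α a y z| := by
  have hc := continuous_weierstrass hα
  rw [setIntegral_unitCube]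
  set μ : Measure ℝ := volume.restrict (Set.Icc (0:ℝ) 1) with hμ
  have : IsProbabilityMeasure μ := ⟨by simp [hμ]⟩
  set g : Fin d → ℝ → ℝ := fun i t => weierstrass α (x i - t) - weierstrass α (y i - t) with hg_def
  set ψ : ℝ → ℝ := fun t => Real.sin (2 * Real.pi * 2 ^ k * (t - (x j + y j) / 2)) with hψ_def
  have hg : ∀ i, Continuous (g i) := fun i => by fun_prop
  have hψ : Continuous ψ := by fun_prop
  have hInt : ∀ F : (Fin d → ℝ) → ℝ, Continuous F → Integrable F (Measure.pi fun _ => μ) := by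
    intro F hF
    rw [hμ, ← Measure.restrict_pi_pi]
    exact hF.continuousOn.integrableOn_compact (isCompact_univ_pi fun _ => isCompact_Icc)
  have hIcc : ∀ f : ℝ → ℝ, ∫ t, f t ∂μ = ∫ t in (0:ℝ)..1, f t := fun f => by
    rw [intervalIntegral.integral_of_le zero_le_one, hμ, integral_Icc_eq_integral_Ioc]
  have hψ0 : ∫ t, ψ t ∂μ = 0 := by
    rw [hIcc]
    convert integral_sin_int_mul_add (n := 2 ^ k) (by positivity)
      (-(2 * Real.pi * 2 ^ k * ((x j + y j) / 2))) using 3 with t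
    simp only [hψ_def]
    push_cast
    ring_nf
  have hsum := integral_pi_sum_mul_eval μ hg hψ j
    (fun i => hInt _ (by have := hg i; fun_prop)) hψ0
  rw [hIcc, integral_weierstrass_sub_mul_sin hα] at hsum
  have hdiff : ∀ z : Fin d → ℝ, weierstrassGraphon d α a x (WithLp.toLp 2 z) -
      weierstrassGraphon d α a y (WithLp.toLp 2 z) = a * ∑ i, g i (z i) := fun z => by
    simp only [weierstrassGraphon, hg_def, Finset.sum_sub_distrib]
    ring
  simp_rw [hdiff, abs_mul, abs_of_pos ha]
  rw [integral_const_mul]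
  refine mul_le_mul_of_nonneg_left ?_ ha.le
  have hpos : 0 < (2:ℝ) ^ (-(k:ℝ) * α) := by positivity
  nth_rw 1 [← abs_of_pos hpos]
  rw [← abs_mul, ← hsum]
  refine abs_integral_le_integral_abs.trans (integral_mono (hInt _ ?_) (hInt _ ?_) fun z => ?_)
  · fun_prop
  · fun_prop
  · simp only [abs_mul]
    exact mul_le_of_le_one_right (abs_nonneg _) (Real.abs_sin_le_one _)

/-- There is `c > 0` with
`∫_{[0,1]^d} |W(x,z) − W(y,z)| dz ≥ c (Σ_i ⟨x_i − y_i⟩)^α`, where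
`⟨t⟩ = min(|t|, 1 − |t|)` is the circle distance. -/
theorem weierstrassGraphon_integral_lower_bound (d : ℕ) (hd : 2 ≤ d)
    (α : ℝ) (hα0 : 0 < α) (hα1 : α < 1) (a : ℝ) (ha : 0 < a)
    (ha' : a * d * ∑' k : ℕ, (2:ℝ) ^ (-(k:ℝ) * α) ≤ 1 / 2) :
    ∃ c : ℝ, 0 < c ∧ ∀ x ∈ unitCube d, ∀ y ∈ unitCube d,
      c * (∑ i, min |x i - y i| (1 - |x i - y i|)) ^ α ≤
        ∫ z in unitCube d,
          |weierstrassGraphon d α a x z - weierstrassGraphon d α a y z| := by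
  have hd0 : (0:ℝ) < d := by
    have : 0 < d := by omega
    exact_mod_cast this
  refine ⟨a / 2 / (d:ℝ) ^ α, by positivity, fun x hx y hy => ?_⟩
  have hle : ∀ i, |x i - y i| ≤ 1 := fun i => by
    have h1 := hx i
    have h2 := hy i
    rw [abs_le]
    constructor <;> linarith [h1.1, h1.2, h2.1, h2.2]
  have hnn : ∀ i, 0 ≤ min |x i - y i| (1 - |x i - y i|) := fun i =>
    le_min (abs_nonneg _) (by linarith [hle i])
  have : Nonempty (Fin d) := ⟨⟨0, by omega⟩⟩
  obtain ⟨j, hj⟩ := Finite.exists_max fun i => min |x i - y i| (1 - |x i - y i|)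
  have hsum : ∑ i, min |x i - y i| (1 - |x i - y i|) ≤
      d * min |x j - y j| (1 - |x j - y j|) := by
    simpa using Finset.sum_le_card_nsmul Finset.univ _ _ fun i _ => hj i
  have hpow : a / 2 / (d:ℝ) ^ α * (∑ i, min |x i - y i| (1 - |x i - y i|)) ^ α ≤
      a * (1 / 2 * (min |x j - y j| (1 - |x j - y j|)) ^ α) := by
    calc _ ≤ a / 2 / (d:ℝ) ^ α * (d * min |x j - y j| (1 - |x j - y j|)) ^ α := by
          refine mul_le_mul_of_nonneg_left ?_ (by positivity)
          exact Real.rpow_le_rpow (Finset.sum_nonneg fun i _ => hnn i) hsum hα0.le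
      _ = _ := by
          rw [Real.mul_rpow hd0.le (hnn j)]
          field_simp
  refine hpow.trans ?_
  rcases (hnn j).eq_or_lt with h0 | h0
  · rw [← h0, Real.zero_rpow hα0.ne']
    simpa using integral_nonneg fun z => abs_nonneg _
  · obtain ⟨k, hk⟩ := exists_half_rpow_le_abs_sin hα0 h0
    exact (mul_le_mul_of_nonneg_left hk ha.le).trans
      (weierstrassGraphon_integral_ge_term hα0 ha x y j k)
end
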